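/- (Vajda identity) Let a, b, c ≥ 1 be integers and let x ∈ ℂ with x³ ≠ 1. Then for all integers n, p, q ≥ 0, (x² + x + 1)²·(BJ(n+p)·BJ(n+q) - BJ(n)·BJ(n+p+q)) = (x² + x + 1)·A(p)·A(q)·Φ1·Φ2 + x^(n+1)·Θ·((Z(n+q+p) - x^p·Z(n+q)) - x^q·(Z(n+p) - x^p·Z(n))) in H. -/

import Mathlib

noncomputable section

/-- The bihyperbolic numbers over `ℂ`: the group algebra of the Klein four-group
`(ZMod 2 × ZMod 2, +)` over `ℂ`.  Its `ℂ`-basis is `1, j1, j2, j3` with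
`j1² = j2² = j3² = 1`, `j1*j2 = j3`, `j1*j3 = j2`, `j2*j3 = j1`. -/
abbrev H : Type := AddMonoidAlgebra ℂ (ZMod 2 × ZMod 2)

def j1 : H := AddMonoidAlgebra.single (1, 0) 1
def j2 : H := AddMonoidAlgebra.single (0, 1) 1
def j3 : H := AddMonoidAlgebra.single (1, 1) 1

/-- The third-order Jacobsthal polynomial sequence (evaluated at `x : ℂ`). -/
def J (x : ℂ) : ℕ → ℂ
  | 0 => 0
  | 1 => 1
  | 2 => x - 1
  | n + 3 => (x - 1) * J x (n + 2) + (x - 1) * J x (n + 1) + x * J x n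

/-- The generalized bihyperbolic third-order Jacobsthal polynomial
`BJ_n^{(a,b,c)}(x) = J_n(x) + J_{n+a}(x) j1 + J_{n+b}(x) j2 + J_{n+c}(x) j3`. -/
def BJ (x : ℂ) (a b c n : ℕ) : H :=
  algebraMap ℂ H (J x n) + algebraMap ℂ H (J x (n + a)) * j1
    + algebraMap ℂ H (J x (n + b)) * j2 + algebraMap ℂ H (J x (n + c)) * j3

/-- `Θ(y) = 1 + y^a j1 + y^b j2 + y^c j3`; used for `Θ = Th x a b c`,
`Φ1 = Th ω1 a b c`, `Φ2 = Th ω2 a b c`. -/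
def Th (y : ℂ) (a b c : ℕ) : H :=
  1 + algebraMap ℂ H (y ^ a) * j1 + algebraMap ℂ H (y ^ b) * j2
    + algebraMap ℂ H (y ^ c) * j3

/-- `Z_n(x) = ((ω1 x - 1) ω1^n Φ1 - (ω2 x - 1) ω2^n Φ2) / (ω1 - ω2)`. -/
def Z (x ω1 ω2 : ℂ) (a b c n : ℕ) : H :=
  algebraMap ℂ H (ω1 - ω2)⁻¹ *
    (algebraMap ℂ H ((ω1 * x - 1) * ω1 ^ n) * Th ω1 a b c
      - algebraMap ℂ H ((ω2 * x - 1) * ω2 ^ n) * Th ω2 a b c)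

/-- `A_k = (ω1^k - ω2^k) / (ω1 - ω2)`. -/
def A (ω1 ω2 : ℂ) (k : ℕ) : ℂ := (ω1 ^ k - ω2 ^ k) / (ω1 - ω2)

theorem add_eq_neg_one_of_roots {ω1 ω2 : ℂ} (hω1 : ω1 ^ 2 + ω1 + 1 = 0)
    (hω2 : ω2 ^ 2 + ω2 + 1 = 0) (hω : ω1 ≠ ω2) : ω1 + ω2 = -1 := by
  apply mul_left_cancel₀ (sub_ne_zero.mpr hω)
  linear_combination hω1 - hω2

theorem mul_eq_one_of_roots {ω1 ω2 : ℂ} (hω1 : ω1 ^ 2 + ω1 + 1 = 0)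
    (hω2 : ω2 ^ 2 + ω2 + 1 = 0) (hω : ω1 ≠ ω2) : ω1 * ω2 = 1 := by
  linear_combination ω1 * add_eq_neg_one_of_roots hω1 hω2 hω - hω1

/-- Binet's formula for the third-order Jacobsthal polynomials. -/
theorem J_binet (x : ℂ) {ω1 ω2 : ℂ} (hω1 : ω1 ^ 2 + ω1 + 1 = 0)
    (hω2 : ω2 ^ 2 + ω2 + 1 = 0) (hω : ω1 ≠ ω2) (n : ℕ) :
    (x ^ 2 + x + 1) * J x n = x ^ (n + 1)
      - (ω1 - ω2)⁻¹ * ((ω1 * x - 1) * ω1 ^ n - (ω2 * x - 1) * ω2 ^ n) := by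
  have hd : (ω1 - ω2)⁻¹ * (ω1 - ω2) = 1 := inv_mul_cancel₀ (sub_ne_zero.mpr hω)
  have hs := add_eq_neg_one_of_roots hω1 hω2 hω
  induction n using J.induct with
  | case1 =>
    simp only [J]
    linear_combination x * hd
  | case2 =>
    simp only [J]
    linear_combination (x * (ω1 + ω2) - 1) * hd + x * hs
  | case3 =>
    simp only [J]
    linear_combination (ω1 - ω2)⁻¹ * ((ω1 * x - 1) * hω1 - (ω2 * x - 1) * hω2
      - x * (hω1 - hω2)) + hd
  | case4 n h2 h1 h0 =>
    simp only [J, Nat.succ_eq_add_one]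
    linear_combination (x - 1) * h2 + (x - 1) * h1 + x * h0
      + (ω1 - ω2)⁻¹ * ((ω1 * x - 1) * ω1 ^ n * (ω1 - x) * hω1
        - (ω2 * x - 1) * ω2 ^ n * (ω2 - x) * hω2)

/-- Binet's formula for the bihyperbolic third-order Jacobsthal polynomials. -/
theorem BJ_binet (a b c : ℕ) (x : ℂ) {ω1 ω2 : ℂ} (hω1 : ω1 ^ 2 + ω1 + 1 = 0)
    (hω2 : ω2 ^ 2 + ω2 + 1 = 0) (hω : ω1 ≠ ω2) (n : ℕ) :
    algebraMap ℂ H (x ^ 2 + x + 1) * BJ x a b c n =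
      algebraMap ℂ H (x ^ (n + 1)) * Th x a b c - Z x ω1 ω2 a b c n := by
  have h (m : ℕ) := congrArg (algebraMap ℂ H) (J_binet x hω1 hω2 hω m)
  have h0 := h n
  have ha := h (n + a)
  have hb := h (n + b)
  have hc := h (n + c)
  simp only [BJ, Th, Z]
  simp only [map_mul, map_sub, map_pow, map_one] at h0 ha hb hc ⊢
  linear_combination h0 + j1 * ha + j2 * hb + j3 * hc

/-- Vajda's identity for the `Z` part of Binet's formula. -/
theorem Z_vajda (a b c : ℕ) (x : ℂ) {ω1 ω2 : ℂ} (hω1 : ω1 ^ 2 + ω1 + 1 = 0)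
    (hω2 : ω2 ^ 2 + ω2 + 1 = 0) (hω : ω1 ≠ ω2) (n p q : ℕ) :
    Z x ω1 ω2 a b c (n + p) * Z x ω1 ω2 a b c (n + q)
        - Z x ω1 ω2 a b c n * Z x ω1 ω2 a b c (n + p + q) =
      algebraMap ℂ H ((x ^ 2 + x + 1) * A ω1 ω2 p * A ω1 ω2 q) *
        (Th ω1 a b c * Th ω2 a b c) := by
  have hs := add_eq_neg_one_of_roots hω1 hω2 hω
  have hp := mul_eq_one_of_roots hω1 hω2 hω
  have hn : ω1 ^ n * ω2 ^ n = 1 := by rw [← mul_pow, hp, one_pow]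
  have key : (ω1 * x - 1) * (ω2 * x - 1) * (ω1 ^ n * ω2 ^ n) = x ^ 2 + x + 1 := by
    rw [hn]
    linear_combination x ^ 2 * hp - x * hs
  simp only [A, Z, ← key, div_eq_mul_inv]
  generalize Th ω1 a b c = Φ1
  generalize Th ω2 a b c = Φ2
  simp only [map_mul, map_sub, map_pow, pow_add]
  ring

theorem BJ_vajda (a b c : ℕ) (ha : 1 ≤ a) (hb : 1 ≤ b) (hc : 1 ≤ c) (x : ℂ) (hx : x ^ 3 ≠ 1)
    (ω1 ω2 : ℂ) (hω1 : ω1 ^ 2 + ω1 + 1 = 0) (hω2 : ω2 ^ 2 + ω2 + 1 = 0)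
    (hω : ω1 ≠ ω2) (n p q : ℕ) :
    algebraMap ℂ H ((x ^ 2 + x + 1) ^ 2) *
        (BJ x a b c (n + p) * BJ x a b c (n + q)
          - BJ x a b c n * BJ x a b c (n + p + q)) =
      algebraMap ℂ H ((x ^ 2 + x + 1) * A ω1 ω2 p * A ω1 ω2 q) *
        (Th ω1 a b c * Th ω2 a b c)
      + algebraMap ℂ H (x ^ (n + 1)) * Th x a b c *
          ((Z x ω1 ω2 a b c (n + q + p) - algebraMap ℂ H (x ^ p) * Z x ω1 ω2 a b c (n + q))
            - algebraMap ℂ H (x ^ q) *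
              (Z x ω1 ω2 a b c (n + p) - algebraMap ℂ H (x ^ p) * Z x ω1 ω2 a b c n)) := by
  have h (m : ℕ) := BJ_binet a b c x hω1 hω2 hω m
  have hZ := Z_vajda a b c x hω1 hω2 hω n p q
  rw [← hZ, map_pow]
  calc
    _ = (algebraMap ℂ H (x ^ 2 + x + 1) * BJ x a b c (n + p))
          * (algebraMap ℂ H (x ^ 2 + x + 1) * BJ x a b c (n + q))
        - (algebraMap ℂ H (x ^ 2 + x + 1) * BJ x a b c n)
          * (algebraMap ℂ H (x ^ 2 + x + 1) * BJ x a b c (n + p + q)) := by ring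
    _ = _ := by
      rw [h, h, h, h, add_right_comm n q p]
      simp only [map_pow]
      ring
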